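/- arXiv:2011.12822 — 3 statements merged into one kernel-verified Lean document; each statement's English description precedes it below -/
import Mathlib

section
/- There exists a real constant α > 1 such that for infinitely many positive integers n there is a word of length n over a three-letter alphabet having at least α^n distinct square-free reducts; equivalently, f_3(n) ≥ α^n for infinitely many n, where f_3(n) is the maximum of r(W) over all words W of length n over a three-letter alphabet. -/
/-- A single square reduction: a word `U ++ (X ++ X) ++ V` (with `X` nonempty)
is replaced by `U ++ X ++ V`. -/
def Step {α : Type*} (W W' : List α) : Prop :=
  ∃ U X V : List α, X ≠ [] ∧ W = U ++ (X ++ X) ++ V ∧ W' = U ++ X ++ V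

/-- `Reaches W W'` : `W'` is obtainable from `W` by a finite sequence of square reductions. -/
def Reaches {α : Type*} (W W' : List α) : Prop := Relation.ReflTransGen Step W W'

/-- A word is square-free if it contains no square `X ++ X` (with `X` nonempty) as a factor. -/
def SquareFree {α : Type*} (W : List α) : Prop :=
  ∀ X : List α, X ≠ [] → ¬ (X ++ X) <:+: W

/-- The set of square-free reducts of `W`. -/
def Reducts {α : Type*} (W : List α) : Set (List α) := {R | Reaches W R ∧ SquareFree R}

/-- `f` has no square among its first `N` letters. -/
def SquareFreeUpTo {α : Type*} (f : ℕ → α) (N : ℕ) : Prop :=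
  ∀ i l, 0 < l → i + 2 * l ≤ N → ∃ j < l, f (i + j) ≠ f (i + l + j)

theorem SquareFreeUpTo.squareFree {α : Type*} {f : ℕ → α} {N : ℕ} (h : SquareFreeUpTo f N) :
    SquareFree ((List.range N).map f) := by
  rintro X hX ⟨s, t, hst⟩
  have hlen := congrArg List.length hst
  simp only [List.length_append, List.length_map, List.length_range] at hlen
  obtain ⟨j, hj, hne⟩ := h s.length X.length (List.length_pos_iff.2 hX) (by omega)
  have get (k : ℕ) (hk : k < N) : (s ++ (X ++ X) ++ t)[k]? = some (f k) := by
    rw [hst]; simp [hk]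
  have h1 := get (s.length + j) (by omega)
  have h2 := get (s.length + X.length + j) (by omega)
  rw [List.append_assoc, List.append_assoc, List.getElem?_append_right (by omega),
    List.getElem?_append_left (by omega)] at h1
  rw [List.append_assoc, List.append_assoc, List.getElem?_append_right (by omega),
    List.getElem?_append_right (by omega), List.getElem?_append_left (by omega)] at h2
  rw [show s.length + j - s.length = j by omega] at h1
  rw [show s.length + X.length + j - s.length - X.length = j by omega] at h2
  exact hne (Option.some.inj (h1.symm.trans h2))

/-! ### Reductions in context -/

theorem Step.append {α : Type*} {A B : List α} (h : Step A B) (P Q : List α) :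
    Step (P ++ A ++ Q) (P ++ B ++ Q) := by
  obtain ⟨U, X, V, hX, rfl, rfl⟩ := h
  exact ⟨P ++ U, X, V ++ Q, hX, by simp, by simp⟩

theorem Reaches.append {α : Type*} {A B : List α} (h : Reaches A B) (P Q : List α) :
    Reaches (P ++ A ++ Q) (P ++ B ++ Q) :=
  Relation.ReflTransGen.lift (fun L => P ++ L ++ Q) (fun _ _ hs => Step.append hs P Q) _ _ h

theorem Step.map {α β : Type*} {A B : List α} (h : Step A B) (f : α → β) :
    Step (A.map f) (B.map f) := by
  obtain ⟨U, X, V, hX, rfl, rfl⟩ := h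
  exact ⟨U.map f, X.map f, V.map f, by simpa using hX, by simp, by simp⟩

theorem Reaches.map {α β : Type*} {A B : List α} (h : Reaches A B) (f : α → β) :
    Reaches (A.map f) (B.map f) :=
  Relation.ReflTransGen.lift (List.map f) (fun _ _ hs => Step.map hs f) _ _ h

theorem Reaches.flatMap {α β : Type*} {f g : β → List α} (h : ∀ x, Reaches (f x) (g x))
    (L : List β) : Reaches (L.flatMap f) (L.flatMap g) := by
  induction L with
  | nil => exact Relation.ReflTransGen.refl
  | cons x L ih =>
    have h1 := (h x).append [] (L.flatMap f)
    have h2 := ih.append (g x) []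
    simp only [List.nil_append, List.append_nil] at h1 h2
    exact h1.trans h2

theorem reducts_finite {α : Type*} [Finite α] (W : List α) : (Reducts W).Finite := by
  refine (List.finite_length_le α W.length).subset ?_
  rintro R ⟨hR, -⟩
  induction hR with
  | refl => exact le_refl W.length
  | tail _ hs ih =>
    obtain ⟨U, X, V, -, rfl, rfl⟩ := hs
    simp only [Set.mem_ofPred_eq, List.length_append] at ih ⊢
    omega

/-! ### The block substitution -/

/-- The two blocks of length `23`, shifted cyclically by `x`, as little-endian base-`4` numerals. -/
def blockCode : Fin 3 → Bool → ℕ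
  | 0, true => 6760700126756
  | 0, false => 6760582161956
  | 1, true => 26699165485129
  | 1, false => 26699200874569
  | 2, true => 36908878565778
  | 2, false => 36908961141138

/-- Letter `j` of the block `b`, shifted cyclically by `x`. -/
def block (x : Fin 3) (b : Bool) (j : ℕ) : Fin 3 :=
  Fin.ofNat 3 (blockCode x b / 4 ^ j % 4)

/-- The word in which letter `a` of `w` is replaced by the block selected by `b a`. -/
def blockWord (w : ℕ → Fin 3) (b : ℕ → Bool) (n : ℕ) : Fin 3 :=
  block (w (n / 23)) (b (n / 23)) (n % 23)

theorem block_add (k x : Fin 3) (b : Bool) {j : ℕ} (hj : j < 23) :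
    block (k + x) b j = k + block x b j := by
  revert k x b j; decide +kernel

/-- The word reducing to both blocks. -/
def bigBlock (x : Fin 3) : List (Fin 3) :=
  [0, 1, 2, 0, 2, 1, 2, 0, 1, 0, 2, 0, 1, 0, 1, 2, 1, 0, 2, 0, 1, 0, 2, 0, 2, 1, 2, 0, 2, 1, 0].map
    (x + ·)

theorem bigBlock_reaches (x : Fin 3) (b : Bool) :
    Reaches (bigBlock x) ((List.range 23).map (block x b)) := by
  have key : (List.range 23).map (block x b) = ((List.range 23).map (block 0 b)).map (x + ·) := by
    rw [List.map_map]
    refine List.map_congr_left fun j hj => ?_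
    simpa using block_add x 0 b (List.mem_range.1 hj)
  rw [key]
  refine Reaches.map ?_ _
  cases b
  · refine ((Relation.ReflTransGen.single
      ⟨[0,1,2,0,2,1], [2,0,1,0], [1,2,1,0,2,0,1,0,2,0,2,1,2,0,2,1,0], by simp, rfl, rfl⟩).tail
      ⟨[0,1,2,0,2,1,2], [0,1], [2,1,0,2,0,1,0,2,0,2,1,2,0,2,1,0], by simp, rfl, rfl⟩).tail
      ⟨[0,1,2,0,2,1,2,0,1,2,1,0,2,0,1], [0,2], [1,2,0,2,1,0], by simp, rfl, ?_⟩
    decide +kernel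
  · refine ((Relation.ReflTransGen.single
      ⟨[0,1,2,0,2,1,2,0,1,0,2], [0,1], [2,1,0,2,0,1,0,2,0,2,1,2,0,2,1,0], by simp, rfl, rfl⟩).tail
      ⟨[0,1,2,0,2,1,2,0,1,0,2,0,1,2], [1,0,2,0], [2,1,2,0,2,1,0], by simp, rfl, rfl⟩).tail
      ⟨[0,1,2,0,2,1,2,0,1,0,2,0,1,2,1], [0,2], [1,2,0,2,1,0], by simp, rfl, ?_⟩
    decide +kernel

/-- Letter `j` of the concatenation of three blocks. -/
def tripleBlock (x y z : Fin 3) (b c d : Bool) (j : ℕ) : Fin 3 :=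
  if j < 23 then block x b j else if j < 46 then block y c (j - 23) else block z d (j - 46)

theorem tripleBlock_add (k x y z : Fin 3) (b c d : Bool) {j : ℕ} (hj : j < 69) :
    tripleBlock (k + x) (k + y) (k + z) b c d j = k + tripleBlock x y z b c d j := by
  unfold tripleBlock
  split_ifs
  all_goals exact block_add _ _ _ (by omega)

/-- The concatenation of three blocks, as a little-endian base-`4` numeral. -/
def tripleCode (x y z : Fin 3) (b c d : Bool) : ℕ :=
  blockCode x b + 4 ^ 23 * (blockCode y c + 4 ^ 23 * blockCode z d)

theorem tripleBlock_val : ∀ (x y z : Fin 3) (b c d : Bool), ∀ j < 69,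
    (tripleBlock x y z b c d j).val = tripleCode x y z b c d / 4 ^ j % 4 := by
  decide +kernel

theorem exists_digit_ne {A B p q l : ℕ} (h : A / 4 ^ p % 4 ^ l ≠ B / 4 ^ q % 4 ^ l) :
    ∃ j < l, A / 4 ^ (p + j) % 4 ≠ B / 4 ^ (q + j) % 4 := by
  induction l with
  | zero => simp [Nat.mod_one] at h
  | succ l ih =>
    by_cases hl : A / 4 ^ p % 4 ^ l = B / 4 ^ q % 4 ^ l
    · refine ⟨l, l.lt_succ_self, fun heq => h ?_⟩
      rw [Nat.mod_pow_succ, Nat.mod_pow_succ, hl, Nat.div_div_eq_div_mul, Nat.div_div_eq_div_mul,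
        ← pow_add, ← pow_add, heq]
    · obtain ⟨j, hj, hne⟩ := ih hl
      exact ⟨j, hj.trans l.lt_succ_self, hne⟩

theorem tripleCode_short_squareFree : ∀ x y z : Fin 3, x ≠ y → y ≠ z → ∀ b c d : Bool,
    ∀ r < 23, ∀ l < 14, 0 < l →
      tripleCode x y z b c d / 4 ^ r % 4 ^ l ≠ tripleCode x y z b c d / 4 ^ (r + l) % 4 ^ l := by
  decide +kernel

theorem tripleCode_synchronizing : ∀ y : Fin 3, 0 ≠ y → ∀ b c : Bool,
    ∀ x' y' : Fin 3, x' ≠ y' → ∀ b' c' : Bool, ∀ r < 23, ∀ r' < r,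
      tripleCode 0 y 0 b c true / 4 ^ r % 4 ^ 14 ≠
        tripleCode x' y' 0 b' c' true / 4 ^ r' % 4 ^ 14 := by
  decide +kernel

theorem tripleBlock_short_squareFree {x y z : Fin 3} (hxy : x ≠ y) (hyz : y ≠ z) (b c d : Bool)
    {r l : ℕ} (hr : r < 23) (hl : l < 14) (hpos : 0 < l) :
    ∃ j < l, tripleBlock x y z b c d (r + j) ≠ tripleBlock x y z b c d (r + l + j) := by
  obtain ⟨j, hj, hne⟩ := exists_digit_ne
    (tripleCode_short_squareFree x y z hxy hyz b c d r hr l hl hpos)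
  refine ⟨j, hj, fun h => hne ?_⟩
  rw [← tripleBlock_val _ _ _ _ _ _ _ (by omega), ← tripleBlock_val _ _ _ _ _ _ _ (by omega), h]

theorem tripleBlock_synchronizing {x y x' y' : Fin 3} (h : x ≠ y) (h' : x' ≠ y')
    (b c b' c' : Bool) {r r' : ℕ} (hr : r < 23) (hr' : r' < r) :
    ∃ j < 14, tripleBlock x y x b c true (r + j) ≠ tripleBlock x' y' x b' c' true (r' + j) := by
  obtain ⟨j, hj, hne⟩ := exists_digit_ne
    (tripleCode_synchronizing (-x + y) (by rwa [ne_comm, Ne, neg_add_eq_zero]) b c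
      (-x + x') (-x + y') (by simpa using h') b' c' r hr r' hr')
  refine ⟨j, hj, fun heq => hne ?_⟩
  rw [← tripleBlock_val _ _ _ _ _ _ _ (by omega), ← tripleBlock_val _ _ _ _ _ _ _ (by omega),
    ← neg_add_cancel x, tripleBlock_add _ _ _ _ _ _ _ (by omega),
    tripleBlock_add _ _ _ _ _ _ _ (by omega), heq]

theorem block_last (x : Fin 3) (b : Bool) : block x b 22 = x := by
  revert x b; decide +kernel

theorem block_nine_injective (x : Fin 3) (b c : Bool) (h : block x b 9 = block x c 9) : b = c := by
  revert x b c; decide +kernel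

theorem blockWord_mul_add (w : ℕ → Fin 3) (b : ℕ → Bool) (a : ℕ) {j : ℕ} (hj : j < 23) :
    blockWord w b (23 * a + j) = block (w a) (b a) j := by
  unfold blockWord
  rw [show (23 * a + j) / 23 = a by omega, show (23 * a + j) % 23 = j by omega]

theorem blockWord_eq_tripleBlock (w : ℕ → Fin 3) (b : ℕ → Bool) (a : ℕ) {j : ℕ} (hj : j < 69) :
    blockWord w b (23 * a + j) =
      tripleBlock (w a) (w (a + 1)) (w (a + 2)) (b a) (b (a + 1)) (b (a + 2)) j := by
  unfold tripleBlock
  split_ifs with h1 h2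
  · exact blockWord_mul_add w b a h1
  · rw [show 23 * a + j = 23 * (a + 1) + (j - 23) by omega]
    exact blockWord_mul_add w b _ (by omega)
  · rw [show 23 * a + j = 23 * (a + 2) + (j - 46) by omega]
    exact blockWord_mul_add w b _ (by omega)

theorem SquareFreeUpTo.ne_succ {α : Type*} {w : ℕ → α} {N : ℕ} (h : SquareFreeUpTo w N) {a : ℕ}
    (ha : a + 1 < N) : w a ≠ w (a + 1) := by
  obtain ⟨j, hj, hne⟩ := h a 1 one_pos (by omega)
  obtain rfl : j = 0 := by omega
  exact hne

/-- Equal windows of length `14` start at the same offset inside their blocks. -/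
theorem blockWord_window_mod {w : ℕ → Fin 3} {b : ℕ → Bool} {p p' : ℕ}
    (hp : w (p / 23) ≠ w (p / 23 + 1)) (hp' : w (p' / 23) ≠ w (p' / 23 + 1))
    (h : ∀ j < 14, blockWord w b (p + j) = blockWord w b (p' + j)) : p' % 23 ≤ p % 23 := by
  by_contra! hlt
  obtain ⟨j, hj, hne⟩ := tripleBlock_synchronizing hp' hp (b (p' / 23)) (b (p' / 23 + 1))
    (b (p / 23)) (b (p / 23 + 1)) (Nat.mod_lt p' (by norm_num)) hlt
  have eq_triple (n : ℕ) : tripleBlock (w (n / 23)) (w (n / 23 + 1)) (w (p' / 23)) (b (n / 23))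
      (b (n / 23 + 1)) true (n % 23 + j) = blockWord w b (n + j) := by
    conv_rhs => rw [← Nat.div_add_mod n 23, add_assoc]
    rw [blockWord_eq_tripleBlock w b _ (by omega)]
    simp [tripleBlock, show n % 23 + j < 46 by omega]
  rw [eq_triple, eq_triple] at hne
  exact hne (h j hj).symm

theorem SquareFreeUpTo.blockWord {w : ℕ → Fin 3} {N : ℕ} (h : SquareFreeUpTo w (N + 2))
    (b : ℕ → Bool) : SquareFreeUpTo (blockWord w b) (23 * N) := by
  intro i l hl hN
  by_contra! hsq
  by_cases hl14 : l < 14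
  · obtain ⟨j, hj, hne⟩ := tripleBlock_short_squareFree
      (h.ne_succ (a := i / 23) (by omega)) (h.ne_succ (a := i / 23 + 1) (by omega))
      (b (i / 23)) (b (i / 23 + 1)) (b (i / 23 + 2)) (Nat.mod_lt i (by norm_num)) hl14 hl
    rw [← blockWord_eq_tripleBlock w b _ (by omega), ← blockWord_eq_tripleBlock w b _ (by omega),
      show 23 * (i / 23) + (i % 23 + j) = i + j by omega,
      show 23 * (i / 23) + (i % 23 + l + j) = i + l + j by omega] at hne
    exact hne (hsq j hj)
  · have hi := h.ne_succ (a := i / 23) (by omega)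
    have hil := h.ne_succ (a := (i + l) / 23) (by omega)
    have h1 := blockWord_window_mod hi hil (b := b) fun j hj => hsq j (by omega)
    have h2 := blockWord_window_mod hil hi (b := b) fun j hj => (hsq j (by omega)).symm
    obtain ⟨m, rfl⟩ : ∃ m, l = 23 * m := ⟨l / 23, by omega⟩
    obtain ⟨k, hk, hne⟩ := h (i / 23) m (by omega) (by omega)
    have hlast (a : ℕ) : _root_.blockWord w b (23 * a + 22) = w a := by
      rw [blockWord_mul_add w b a (by norm_num), block_last]
    have := hsq (23 * k + (22 - i % 23)) (by omega)
    rw [show i + (23 * k + (22 - i % 23)) = 23 * (i / 23 + k) + 22 by omega,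
      show i + 23 * m + (23 * k + (22 - i % 23)) = 23 * (i / 23 + m + k) + 22 by omega,
      hlast, hlast] at this
    exact hne this

theorem exists_squareFreeUpTo (N : ℕ) : ∃ w : ℕ → Fin 3, SquareFreeUpTo w (N + 5) := by
  induction N with
  | zero =>
    refine ⟨fun n => Fin.ofNat 3 n, fun i l hl hN => ⟨0, hl, fun h => ?_⟩⟩
    have := congrArg Fin.val h
    simp only [Fin.val_ofNat] at this
    omega
  | succ N ih =>
    obtain ⟨w, hw⟩ := ih
    refine ⟨_root_.blockWord w fun _ => true, fun i l hl hN => ?_⟩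
    exact (SquareFreeUpTo.blockWord (N := N + 3) hw _) i l hl (by omega)

/-! ### Counting reducts -/

theorem flatMap_block_eq_map_blockWord (w : ℕ → Fin 3) (b : ℕ → Bool) (N : ℕ) :
    (List.range N).flatMap (fun a => (List.range 23).map (block (w a) (b a))) =
      (List.range (23 * N)).map (blockWord w b) := by
  induction N with
  | zero => rfl
  | succ N ih =>
    rw [List.range_succ (n := N), List.flatMap_append, ih, Nat.mul_succ, List.range_add,
      List.map_append, List.flatMap_singleton, List.map_map]
    congr 1
    refine List.map_congr_left fun j hj => ?_
    exact (blockWord_mul_add w b N (List.mem_range.1 hj)).symm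

theorem two_pow_le_ncard_reducts {w : ℕ → Fin 3} {N : ℕ} (h : SquareFreeUpTo w (N + 2)) :
    2 ^ N ≤ (Reducts ((List.range N).flatMap fun a => bigBlock (w a))).ncard := by
  let extend (s : Fin N → Bool) (n : ℕ) : Bool := if hn : n < N then s ⟨n, hn⟩ else false
  let reduct (s : Fin N → Bool) : List (Fin 3) :=
    (List.range (23 * N)).map (blockWord w (extend s))
  have hinj : Function.Injective reduct := by
    intro s t hst
    funext ⟨a, ha⟩
    have := List.map_inj_left.1 hst (23 * a + 9) (List.mem_range.2 (by omega))
    rw [blockWord_mul_add _ _ _ (by norm_num), blockWord_mul_add _ _ _ (by norm_num)] at this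
    simpa [extend, ha] using block_nine_injective _ _ _ this
  have hsub : Set.range reduct ⊆ Reducts ((List.range N).flatMap fun a => bigBlock (w a)) := by
    rintro _ ⟨s, rfl⟩
    refine ⟨?_, (h.blockWord _).squareFree⟩
    change Reaches _ ((List.range (23 * N)).map _)
    rw [← flatMap_block_eq_map_blockWord]
    exact Reaches.flatMap (fun a => bigBlock_reaches _ _) _
  calc 2 ^ N = (Set.range reduct).ncard := by
        rw [← Set.image_univ, Set.ncard_image_of_injective _ hinj, Set.ncard_univ]
        simp
    _ ≤ _ := Set.ncard_le_ncard hsub (reducts_finite _)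

/-- There is a real constant `α > 1` such that for infinitely many positive `n` there is a
ternary word of length `n` with at least `α ^ n` distinct square-free reducts. -/
theorem ternary_exponentially_many_reducts :
    ∃ a : ℝ, 1 < a ∧
      {n : ℕ | 0 < n ∧ ∃ W : List (Fin 3), W.length = n ∧
        a ^ n ≤ ((Reducts W).ncard : ℝ)}.Infinite := by
  refine ⟨2 ^ ((31 : ℕ) : ℝ)⁻¹, Real.one_lt_rpow (by norm_num) (by norm_num), ?_⟩
  refine Set.infinite_of_injective_forall_mem (f := fun N : ℕ => 31 * (N + 1))
    (fun M N h => by simpa using h) fun N => ⟨by omega, ?_⟩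
  obtain ⟨w, hw⟩ := exists_squareFreeUpTo N
  refine ⟨(List.range (N + 1)).flatMap fun a => bigBlock (w a), ?_, ?_⟩
  · simp [List.length_flatMap, bigBlock, mul_comm]
  · rw [pow_mul, Real.rpow_inv_natCast_pow (by norm_num) (by norm_num)]
    have := two_pow_le_ncard_reducts (w := w) (N := N + 1)
      fun i l hl hN => hw i l hl (by omega)
    exact_mod_cast this
end

section
/- For every positive integer k there exist infinitely many distinct words over a four-letter alphabet each having exactly k distinct square-free reducts. -/
section Basic

variable {α : Type*}

theorem squareFree_iff_forall_not_step {W : List α} :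
    SquareFree W ↔ ∀ W', ¬ Step W W' := by
  constructor
  · rintro h W' ⟨U, X, V, hX, rfl, -⟩
    exact h X hX ⟨U, V, rfl⟩
  · rintro h X hX ⟨U, V, rfl⟩
    exact h (U ++ X ++ V) ⟨U, X, V, hX, rfl, rfl⟩

theorem Step.append_left {W W' : List α} (h : Step W W') (T : List α) :
    Step (T ++ W) (T ++ W') := by
  obtain ⟨U, X, V, hX, rfl, rfl⟩ := h
  exact ⟨T ++ U, X, V, hX, by simp, by simp⟩

theorem Step.append_right {W W' : List α} (h : Step W W') (T : List α) :
    Step (W ++ T) (W' ++ T) := by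
  obtain ⟨U, X, V, hX, rfl, rfl⟩ := h
  exact ⟨U, X, V ++ T, hX, by simp, by simp⟩

theorem Step.subset {W W' : List α} (h : Step W W') : W' ⊆ W := by
  obtain ⟨U, X, V, hX, rfl, rfl⟩ := h
  intro x
  simp only [List.mem_append]
  tauto

theorem Reaches.subset {W W' : List α} (h : Reaches W W') : W' ⊆ W := by
  induction h with
  | refl => exact List.Subset.refl _
  | tail _ h ih => exact List.Subset.trans h.subset ih

theorem SquareFree.reducts_eq {W : List α} (h : SquareFree W) : Reducts W = {W} := by
  rw [squareFree_iff_forall_not_step] at h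
  ext R
  constructor
  · rintro ⟨hR, -⟩
    rcases Relation.ReflTransGen.cases_head hR with rfl | ⟨W', hW', -⟩
    · rfl
    · exact (h _ hW').elim
  · rintro rfl
    exact ⟨.refl, squareFree_iff_forall_not_step.2 h⟩

theorem append_cons_inj_of_not_mem {e : α} {U U' V V' : List α} (hU : e ∉ U) (hU' : e ∉ U')
    (h : U ++ e :: V = U' ++ e :: V') : U = U' ∧ V = V' := by
  induction U generalizing U' with
  | nil =>
    cases U' with
    | nil => simpa using h
    | cons b U' => exact (hU' (by simp [(List.cons.inj h).1])).elim
  | cons a U ih =>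
    cases U' with
    | nil => exact (hU (by simp [(List.cons.inj h).1])).elim
    | cons b U' =>
      obtain ⟨rfl, h'⟩ := List.cons.inj h
      obtain ⟨rfl, rfl⟩ := ih (fun h => hU (.tail _ h)) (fun h => hU' (.tail _ h)) h'
      exact ⟨rfl, rfl⟩

theorem step_append_singleton {e : α} {V Z : List α} (hV : e ∉ V) (h : Step (V ++ [e]) Z) :
    ∃ V', Step V V' ∧ Z = V' ++ [e] := by
  classical
  obtain ⟨A, X, B, hX, h, rfl⟩ := h
  rcases List.eq_nil_or_concat B with rfl | ⟨B, b, rfl⟩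
  · exfalso
    have hmem : e ∈ X := by
      obtain ⟨X', x, rfl⟩ := (List.eq_nil_or_concat X).resolve_left hX
      have hlast := congrArg List.getLast? h
      rw [List.append_nil, List.concat_eq_append, ← List.append_assoc, ← List.append_assoc,
        List.getLast?_concat, List.getLast?_concat, Option.some.injEq] at hlast
      simp [hlast]
    have h1 := congrArg (List.count e) h
    simp only [List.count_append, List.count_eq_zero_of_not_mem hV, List.count_singleton_self,
      List.count_nil] at h1
    have := List.count_pos_iff.2 hmem
    omega
  · obtain ⟨rfl, h2⟩ := List.append_inj' (t₁ := [e]) (t₂ := [b]) (s₁ := V)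
      (s₂ := A ++ (X ++ X) ++ B) (by simpa using h) rfl
    exact ⟨_, ⟨A, X, B, hX, rfl, rfl⟩, by simpa using h2.symm⟩

theorem step_append_cons_append_singleton {e : α} {U V Z : List α} (hU : e ∉ U) (hV : e ∉ V)
    (h : Step (U ++ e :: (V ++ [e])) Z) :
    (∃ U', Step U U' ∧ Z = U' ++ e :: (V ++ [e])) ∨
    (∃ V', Step V V' ∧ Z = U ++ e :: (V' ++ [e])) ∨
    (V <:+ U ∧ Z = U ++ [e]) := by
  classical
  obtain ⟨A, X, B, hX, h, rfl⟩ := h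
  by_cases hA : e ∈ A
  · obtain ⟨A1, A2, rfl, hA1⟩ := List.eq_append_cons_of_mem hA
    obtain ⟨rfl, h2⟩ := append_cons_inj_of_not_mem (V' := A2 ++ (X ++ X) ++ B) hU hA1
      (by simpa using h)
    obtain ⟨V', hV', hZ⟩ := step_append_singleton hV ⟨A2, X, B, hX, h2, rfl⟩
    refine .inr (.inl ⟨V', hV', ?_⟩)
    simp [← hZ]
  by_cases hXe : e ∈ X
  · obtain ⟨s, p, rfl, hs⟩ := List.eq_append_cons_of_mem hXe
    obtain ⟨rfl, h2⟩ := append_cons_inj_of_not_mem (U' := A ++ s)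
      (V' := p ++ s ++ e :: (p ++ B)) hU (by simp [hA, hs]) (by simpa using h)
    have hp : e ∉ p := by
      intro hp
      have h1 := congrArg (List.count e) h2
      simp only [List.count_append, List.count_eq_zero_of_not_mem hV, List.count_cons_self,
        List.count_nil] at h1
      have := List.count_pos_iff.2 hp
      omega
    obtain ⟨rfl, h3⟩ := append_cons_inj_of_not_mem (V := []) hV (by simp [hp, hs]) h2
    obtain ⟨rfl, rfl⟩ := List.append_eq_nil_iff.1 h3.symm
    exact .inr (.inr ⟨⟨A, rfl⟩, by simp⟩)
  · have hB : e ∈ B := by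
      have : e ∈ A ++ (X ++ X) ++ B := h ▸ by simp
      simpa [hA, hXe] using this
    obtain ⟨B1, B2, rfl, hB1⟩ := List.eq_append_cons_of_mem hB
    obtain ⟨rfl, rfl⟩ := append_cons_inj_of_not_mem (U' := A ++ (X ++ X) ++ B1) (V' := B2) hU
      (by simp [hA, hXe, hB1]) (by simpa using h)
    exact .inl ⟨_, ⟨A, X, B1, hX, rfl, rfl⟩, by simp⟩

end Basic

section Simulation

variable {α β : Type*}

/-- An injective map of words under which square reductions of `φ W` are exactly the images of
square reductions of `W`. -/
structure IsStepEmbedding (φ : List α → List β) : Prop where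
  injective : Function.Injective φ
  map_step : ∀ {W W'}, Step W W' → Step (φ W) (φ W')
  exists_of_step : ∀ {W Z}, Step (φ W) Z → ∃ W', Step W W' ∧ Z = φ W'
  suffix_iff : ∀ {A B}, φ A <:+ φ B ↔ A <:+ B
  map_nil : φ [] = []

variable {φ : List α → List β}

theorem IsStepEmbedding.reducts_eq (hφ : IsStepEmbedding φ) (W : List α) :
    Reducts (φ W) = φ '' Reducts W := by
  have hsf : ∀ R, SquareFree (φ R) ↔ SquareFree R := by
    intro R
    simp only [squareFree_iff_forall_not_step]
    constructor
    · exact fun h W' hW' => h _ (hφ.map_step hW')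
    · intro h Z hZ
      obtain ⟨W', hW', -⟩ := hφ.exists_of_step hZ
      exact h _ hW'
  ext R
  constructor
  · rintro ⟨hR, hs⟩
    have key : ∃ W', Reaches W W' ∧ R = φ W' := by
      clear hs
      induction hR with
      | refl => exact ⟨W, .refl, rfl⟩
      | tail _ h ih =>
        obtain ⟨W', hW', rfl⟩ := ih
        obtain ⟨W'', hW'', rfl⟩ := hφ.exists_of_step h
        exact ⟨W'', hW'.tail hW'', rfl⟩
    obtain ⟨W', hW', rfl⟩ := key
    exact ⟨W', ⟨hW', (hsf _).1 hs⟩, rfl⟩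
  · rintro ⟨R, ⟨hR, hs⟩, rfl⟩
    exact ⟨Relation.ReflTransGen.lift φ (fun _ _ h => hφ.map_step h) _ _ hR, (hsf _).2 hs⟩

theorem IsStepEmbedding.ncard_reducts (hφ : IsStepEmbedding φ) (W : List α) :
    (Reducts (φ W)).ncard = (Reducts W).ncard := by
  rw [hφ.reducts_eq, Set.ncard_image_of_injective _ hφ.injective]

theorem isStepEmbedding_map {f : α → β} (hf : Function.Injective f) :
    IsStepEmbedding (List.map f) where
  injective := List.map_injective_iff.2 hf
  map_step := by
    rintro _ _ ⟨U, X, V, hX, rfl, rfl⟩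
    exact ⟨U.map f, X.map f, V.map f, by simpa using hX, by simp, by simp⟩
  exists_of_step := by
    rintro W Z ⟨U, X, V, hX, h, rfl⟩
    obtain ⟨L, V, rfl, h1, rfl⟩ := List.map_eq_append_iff.1 h
    obtain ⟨U, Y, rfl, rfl, h2⟩ := List.map_eq_append_iff.1 h1
    obtain ⟨X1, X2, rfl, rfl, h3⟩ := List.map_eq_append_iff.1 h2
    obtain rfl := List.map_injective_iff.2 hf h3
    exact ⟨U ++ X2 ++ V, ⟨U, X2, V, by simpa using hX, rfl, rfl⟩, by simp⟩
  suffix_iff := by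
    intro A B
    constructor
    · rintro ⟨T, h⟩
      obtain ⟨T', A', rfl, -, h2⟩ := List.map_eq_append_iff.1 h.symm
      obtain rfl := List.map_injective_iff.2 hf h2
      exact ⟨T', rfl⟩
    · exact fun h => h.map f
  map_nil := rfl

end Simulation

section Deletion

variable {α : Type*}

/-- The word obtained from `W` by deleting `p` letters starting at position `a`. -/
def deleteAt (W : List α) (a p : ℕ) : List α := W.take a ++ W.drop (a + p)

theorem step_iff_deleteAt {W Z : List α} :
    Step W Z ↔ ∃ a p, 0 < p ∧ a + 2 * p ≤ W.length ∧
      (∀ x, a ≤ x → x < a + p → W[x]? = W[x + p]?) ∧ Z = deleteAt W a p := by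
  constructor
  · rintro ⟨U, X, V, hX, rfl, rfl⟩
    refine ⟨U.length, X.length, List.length_pos_iff.2 hX, by simp; omega, ?_, ?_⟩
    · intro x h1 h2
      obtain ⟨y, rfl⟩ := Nat.exists_eq_add_of_le h1
      have hy : y < X.length := by omega
      rw [add_assoc]
      simp only [List.append_assoc, List.getElem?_append_right (Nat.le_add_right _ _),
        Nat.add_sub_cancel_left]
      rw [List.getElem?_append_left hy, add_comm y,
        List.getElem?_append_right (Nat.le_add_right _ _), Nat.add_sub_cancel_left,
        List.getElem?_append_left hy]
    · simp [deleteAt, List.drop_append]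
  · rintro ⟨a, p, hp, hlen, hper, rfl⟩
    have hX : (W.drop a).take p = (W.drop (a + p)).take p := by
      apply List.ext_getElem?
      intro i
      simp only [List.getElem?_take, List.getElem?_drop]
      split_ifs with hi
      · rw [hper _ (by omega) (by omega)]
        congr 1
        omega
      · rfl
    have h1 : (W.drop (a + p)).take p ++ W.drop (a + 2 * p) = W.drop (a + p) := by
      have := List.take_append_drop p (W.drop (a + p))
      rwa [List.drop_drop, show a + p + p = a + 2 * p by omega] at this
    refine ⟨W.take a, (W.drop a).take p, W.drop (a + 2 * p), ?_, ?_, ?_⟩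
    · apply List.ne_nil_of_length_pos
      simp
      omega
    · have h2 : (W.drop a).take p ++ W.drop (a + p) = W.drop a := by
        have := List.take_append_drop p (W.drop a)
        rwa [List.drop_drop] at this
      have h3 : (W.drop a).take p ++ W.drop (a + 2 * p) = W.drop (a + p) := by
        rw [hX, h1]
      simp only [List.append_assoc, h3, h2, List.take_append_drop]
    · rw [hX, List.append_assoc, h1, deleteAt]

theorem getElem?_deleteAt {W : List α} {a p : ℕ} (ha : a ≤ W.length) (x : ℕ) :
    (deleteAt W a p)[x]? = if x < a then W[x]? else W[x + p]? := by
  rw [deleteAt, List.getElem?_append, List.length_take, min_eq_left ha]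
  split_ifs with h
  · rw [List.getElem?_take_of_lt h]
  · rw [List.getElem?_drop]
    congr 1
    omega

theorem deleteAt_eq_of_period {W : List α} {a a' p : ℕ} (haa' : a ≤ a') (ha' : a' ≤ W.length)
    (h : ∀ x, a ≤ x → x < a' → W[x]? = W[x + p]?) : deleteAt W a p = deleteAt W a' p := by
  apply List.ext_getElem?
  intro x
  rw [getElem?_deleteAt (haa'.trans ha'), getElem?_deleteAt ha']
  split_ifs with h1 h2 h2
  · rfl
  · omega
  · exact (h x (by omega) h2).symm
  · rfl

end Deletion

section Encoding

/-- Five permutations of the letters `0, 1, 2`, each followed by the marker letter `3`. -/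
def code : Fin 5 → Fin 4 → Fin 4 :=
  ![![0, 1, 2, 3], ![1, 2, 0, 3], ![2, 0, 1, 3], ![0, 2, 1, 3], ![2, 1, 0, 3]]

/-- The four-letter encoding of a five-letter word. -/
def encode (W : List (Fin 5)) : List (Fin 4) := W.flatMap fun c => List.ofFn (code c)

theorem encode_append (A B : List (Fin 5)) : encode (A ++ B) = encode A ++ encode B := by
  simp [encode]

theorem length_encode (W : List (Fin 5)) : (encode W).length = 4 * W.length := by
  induction W with
  | nil => rfl
  | cons c W ih =>
    rw [← List.singleton_append, encode_append, List.length_append, ih]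
    simp [encode]
    ring

theorem getElem?_encode (W : List (Fin 5)) (t : ℕ) (q : Fin 4) :
    (encode W)[4 * t + q]? = W[t]?.map fun c => code c q := by
  induction W generalizing t with
  | nil => simp [encode]
  | cons c W ih =>
    rw [← List.singleton_append, encode_append]
    cases t with
    | zero =>
      rw [List.getElem?_append_left (by simp [encode])]
      fin_cases q <;> simp [encode]
    | succ t =>
      rw [List.getElem?_append_right (by simp [encode]; omega), length_encode]
      simp only [List.length_singleton, List.singleton_append, List.getElem?_cons_succ, ← ih]
      congr 1
      omega

theorem take_encode (W : List (Fin 5)) (n : ℕ) :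
    (encode W).take (4 * n) = encode (W.take n) := by
  rcases le_total n W.length with h | h
  · conv_lhs => rw [← List.take_append_drop n W, encode_append]
    rw [List.take_left' (by rw [length_encode, List.length_take, min_eq_left h])]
  · rw [List.take_of_length_le h, List.take_of_length_le (by rw [length_encode]; omega)]

theorem drop_encode (W : List (Fin 5)) (n : ℕ) :
    (encode W).drop (4 * n) = encode (W.drop n) := by
  rcases le_total n W.length with h | h
  · conv_lhs => rw [← List.take_append_drop n W, encode_append]
    rw [List.drop_left' (by rw [length_encode, List.length_take, min_eq_left h])]
  · rw [List.drop_of_length_le h, List.drop_of_length_le (by rw [length_encode]; omega)]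
    rfl

theorem deleteAt_encode (W : List (Fin 5)) (a p : ℕ) :
    deleteAt (encode W) (4 * a) (4 * p) = encode (deleteAt W a p) := by
  rw [deleteAt, deleteAt, encode_append, take_encode, ← mul_add, drop_encode]

theorem encode_injective : Function.Injective encode := by
  intro A B h
  have hc : Function.Injective fun c => code c := by decide
  apply List.ext_getElem?
  intro t
  have hq : ∀ q : Fin 4, (A[t]?.map fun c => code c q) = B[t]?.map fun c => code c q := by
    intro q
    rw [← getElem?_encode, ← getElem?_encode, h]
  cases hA : A[t]? <;> cases hB : B[t]? <;> simp only [hA, hB, Option.map_none, Option.map_some,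
    Option.some.injEq, reduceCtorEq, forall_const] at hq ⊢
  exact hc (funext hq)

theorem getElem?_eq_of_encode (W : List (Fin 5)) {s t : ℕ} (q q' : Fin 4) (hq : q ≠ q')
    (hq3 : q ≠ 3) (hq3' : q' ≠ 3) (h : (encode W)[4 * s + q]? = (encode W)[4 * t + q]?)
    (h' : (encode W)[4 * s + q']? = (encode W)[4 * t + q']?)
    (hqq : q = 1 ∨ q' = 1) : W[s]? = W[t]? := by
  have hc : ∀ q q' : Fin 4, q ≠ q' → q ≠ 3 → q' ≠ 3 → (q = 1 ∨ q' = 1) → ∀ c d : Fin 5,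
      code c q = code d q → code c q' = code d q' → c = d := by decide
  rw [getElem?_encode, getElem?_encode] at h h'
  cases hs : W[s]? <;> cases ht : W[t]? <;> simp only [hs, ht, Option.map_none, Option.map_some,
    Option.some.injEq, reduceCtorEq] at h h' ⊢
  exact hc q q' hq hq3 hq3' hqq _ _ h h'

theorem getElem?_encode_congr (W : List (Fin 5)) {s t x y : ℕ} (q : Fin 4) (h : W[s]? = W[t]?)
    (hx : x = 4 * s + q) (hy : y = 4 * t + q) : (encode W)[x]? = (encode W)[y]? := by
  rw [hx, hy, getElem?_encode, getElem?_encode, h]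

theorem getElem?_encode_eq_three_iff (W : List (Fin 5)) {x : ℕ} (hx : x < (encode W).length) :
    (encode W)[x]? = some 3 ↔ x % 4 = 3 := by
  have hc : ∀ c : Fin 5, ∀ q : Fin 4, code c q = 3 ↔ q.val = 3 := by decide
  have h := getElem?_encode W (x / 4) ⟨x % 4, Nat.mod_lt _ (by norm_num)⟩
  simp only [Nat.div_add_mod] at h
  rw [length_encode] at hx
  rw [h, List.getElem?_eq_getElem (by omega)]
  simp [hc]

theorem getElem?_encode_ne_succ (W : List (Fin 5)) {x : ℕ} (hx : x + 1 < (encode W).length) :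
    (encode W)[x]? ≠ (encode W)[x + 1]? := by
  intro h
  by_cases h3 : x % 4 = 3
  · have h1 := (getElem?_encode_eq_three_iff W (by omega : x < _)).2 h3
    rw [h] at h1
    have := (getElem?_encode_eq_three_iff W hx).1 h1
    omega
  · have hc : ∀ c : Fin 5, ∀ q q' : Fin 4, q ≠ q' → code c q ≠ code c q' := by decide
    have e1 := getElem?_encode W (x / 4) ⟨x % 4, Nat.mod_lt _ (by norm_num)⟩
    have e2 := getElem?_encode W (x / 4) ⟨x % 4 + 1, by omega⟩
    simp only [← add_assoc, Nat.div_add_mod] at e1 e2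
    rw [length_encode] at hx
    rw [e1, e2, List.getElem?_eq_getElem (by omega)] at h
    simp only [Option.map_some, Option.some.injEq] at h
    exact hc _ _ _ (by simp [Fin.ext_iff]) h

theorem isStepEmbedding_encode : IsStepEmbedding encode where
  injective := encode_injective
  map_step := by
    rintro _ _ ⟨U, X, V, hX, rfl, rfl⟩
    refine ⟨encode U, encode X, encode V, ?_, by simp [encode_append], by simp [encode_append]⟩
    apply List.ne_nil_of_length_pos
    rw [length_encode]
    have := List.length_pos_iff.2 hX
    omega
  exists_of_step := by
    intro W Z h
    obtain ⟨a, p, hp, hlen, hper, rfl⟩ := step_iff_deleteAt.1 h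
    have hp4 : p % 4 = 0 := by
      by_cases hp3 : p < 4
      · by_cases hp1 : p = 1
        · subst hp1
          exact (getElem?_encode_ne_succ W (by omega) (hper a le_rfl (by omega))).elim
        · obtain ⟨x, hx1, hx2, hx3⟩ : ∃ x, a ≤ x ∧ x < a + 2 * p ∧ x % 4 = 3 :=
            ⟨a + (3 - a % 4), by omega, by omega, by omega⟩
          have h1 := (getElem?_encode_eq_three_iff W (by omega : x < _)).2 hx3
          by_cases hx : x < a + p
          · rw [hper x hx1 hx] at h1
            have := (getElem?_encode_eq_three_iff W (by omega)).1 h1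
            omega
          · have h2 := hper (x - p) (by omega) (by omega)
            rw [Nat.sub_add_cancel (by omega), h1] at h2
            have := (getElem?_encode_eq_three_iff W (by omega)).1 h2
            omega
      · obtain ⟨x, hx1, hx2, hx3⟩ : ∃ x, a ≤ x ∧ x < a + p ∧ x % 4 = 3 :=
          ⟨a + (3 - a % 4), by omega, by omega, by omega⟩
        have h1 := (getElem?_encode_eq_three_iff W (by omega : x < _)).2 hx3
        rw [hper x hx1 hx2] at h1
        have := (getElem?_encode_eq_three_iff W (by omega)).1 h1
        omega
    obtain ⟨m, rfl⟩ : ∃ m, p = 4 * m := ⟨p / 4, by omega⟩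
    rw [length_encode] at hlen
    have hblock : ∀ t q q' : ℕ, a ≤ 4 * t + q → a ≤ 4 * t + q' → 4 * t + q < a + 4 * m →
        4 * t + q' < a + 4 * m → q < 3 → q' < 3 → q ≠ q' → (q = 1 ∨ q' = 1) →
        W[t]? = W[t + m]? := by
      intro t q q' h1 h2 h3 h4 h5 h6 h7 h8
      apply getElem?_eq_of_encode W ⟨q, by omega⟩ ⟨q', by omega⟩ (by simpa [Fin.ext_iff])
        (by simp [Fin.ext_iff]; omega) (by simp [Fin.ext_iff]; omega) _ _
        (by simpa [Fin.ext_iff])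
      · simp only [hper _ h1 h3]
        congr 1
        ring
      · simp only [hper _ h2 h4]
        congr 1
        ring
    obtain ⟨b, hb1, hb2, hb3⟩ : ∃ b, (∀ t, b ≤ t → t < b + m → W[t]? = W[t + m]?) ∧
        b + 2 * m ≤ W.length ∧
        deleteAt (encode W) a (4 * m) = deleteAt (encode W) (4 * b) (4 * m) := by
      by_cases hr : a % 4 ≤ 1
      · refine ⟨a / 4, fun t h1 h2 => hblock t 1 2 ?_ ?_ ?_ ?_ ?_ ?_ ?_ ?_, by omega, ?_⟩ <;>
          try omega
        refine (deleteAt_eq_of_period (by omega) (by rw [length_encode]; omega) ?_).symm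
        intro x h1 h2
        apply getElem?_encode_congr W (s := a / 4) (t := a / 4 + m) 0
        · apply hblock _ 1 2 <;> omega
        · simp; omega
        · simp; omega
      · refine ⟨a / 4 + 1, fun t h1 h2 => hblock t 0 1 ?_ ?_ ?_ ?_ ?_ ?_ ?_ ?_, by omega, ?_⟩ <;>
          try omega
        exact deleteAt_eq_of_period (by omega) (by rw [length_encode]; omega)
          fun x h1 h2 => hper x h1 (by omega)
    rw [hb3, deleteAt_encode]
    exact ⟨_, step_iff_deleteAt.2 ⟨b, m, by omega, hb2, hb1, rfl⟩, rfl⟩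
  suffix_iff := by
    intro A B
    constructor
    · rintro ⟨T, h⟩
      have hl := congrArg List.length h
      rw [List.length_append, length_encode, length_encode] at hl
      have hd : encode (B.drop (B.length - A.length)) = encode A := by
        rw [← drop_encode, ← h, List.drop_left' (by omega)]
      rw [← encode_injective hd]
      exact List.drop_suffix _ _
    · rintro ⟨T, rfl⟩
      exact ⟨encode T, (encode_append _ _).symm⟩
  map_nil := rfl

end Encoding

section Counting

variable {α β : Type*}

/-- `P` is nonempty and has exactly `k` reducts, `Y` has exactly two, `Q₁` and `Q₂`, and `Q₁` is a
suffix of `Q₂` and of every reduct of `P`, while `Q₂` is a suffix of every reduct of `P` but one. -/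
def IsCountingPair (k : ℕ) (P Y : List α) : Prop :=
  P ≠ [] ∧ (Reducts P).ncard = k ∧ ∃ Q₁ Q₂ R₁, Reducts Y = {Q₁, Q₂} ∧ Q₁ <:+ Q₂ ∧
    R₁ ∈ Reducts P ∧ ¬ Q₂ <:+ R₁ ∧ ∀ R ∈ Reducts P, Q₁ <:+ R ∧ (R ≠ R₁ → Q₂ <:+ R)

theorem IsCountingPair.map {φ : List α → List β} (hφ : IsStepEmbedding φ) {k : ℕ}
    {P Y : List α} (h : IsCountingPair k P Y) : IsCountingPair k (φ P) (φ Y) := by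
  obtain ⟨hP, hk, Q₁, Q₂, R₁, hY, hQ, hR₁, hQR, hall⟩ := h
  refine ⟨?_, ?_, φ Q₁, φ Q₂, φ R₁, ?_, hφ.suffix_iff.2 hQ, ?_, mt hφ.suffix_iff.1 hQR, ?_⟩
  · rw [← hφ.map_nil]
    exact hφ.injective.ne hP
  · rw [hφ.ncard_reducts, hk]
  · rw [hφ.reducts_eq, hY, Set.image_pair]
  · rw [hφ.reducts_eq]
    exact Set.mem_image_of_mem _ hR₁
  · rw [hφ.reducts_eq]
    rintro _ ⟨R, hR, rfl⟩
    exact ⟨hφ.suffix_iff.2 (hall R hR).1, fun hne =>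
      hφ.suffix_iff.2 ((hall R hR).2 fun h => hne (h ▸ rfl))⟩

theorem Reaches.append_left {W W' : List α} (h : Reaches W W') (T : List α) :
    Reaches (T ++ W) (T ++ W') :=
  Relation.ReflTransGen.lift (T ++ ·) (fun _ _ h => h.append_left T) _ _ h

theorem Reaches.append_right {W W' : List α} (h : Reaches W W') (T : List α) :
    Reaches (W ++ T) (W' ++ T) :=
  Relation.ReflTransGen.lift (· ++ T) (fun _ _ h => h.append_right T) _ _ h

theorem squareFree_append_singleton {e : α} {V : List α} (hV : e ∉ V) :
    SquareFree (V ++ [e]) ↔ SquareFree V := by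
  simp only [squareFree_iff_forall_not_step]
  constructor
  · exact fun h W' hW' => h _ (hW'.append_right [e])
  · intro h Z hZ
    obtain ⟨V', hV', -⟩ := step_append_singleton hV hZ
    exact h _ hV'

theorem exists_reaches_of_reaches_append_singleton {e : α} {V Z : List α} (hV : e ∉ V)
    (h : Reaches (V ++ [e]) Z) : ∃ V', Reaches V V' ∧ Z = V' ++ [e] := by
  induction h with
  | refl => exact ⟨V, .refl, rfl⟩
  | tail _ h ih =>
    obtain ⟨V', hV', rfl⟩ := ih
    obtain ⟨V'', hV'', rfl⟩ := step_append_singleton (fun h => hV (hV'.subset h)) h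
    exact ⟨V'', hV'.tail hV'', rfl⟩

theorem reducts_append_singleton {e : α} {V : List α} (hV : e ∉ V) :
    Reducts (V ++ [e]) = (· ++ [e]) '' Reducts V := by
  ext R
  constructor
  · rintro ⟨hR, hs⟩
    obtain ⟨V', hV', rfl⟩ := exists_reaches_of_reaches_append_singleton hV hR
    exact ⟨V', ⟨hV', (squareFree_append_singleton fun h => hV (hV'.subset h)).1 hs⟩, rfl⟩
  · rintro ⟨V', ⟨hV', hs⟩, rfl⟩
    exact ⟨hV'.append_right _, (squareFree_append_singleton fun h => hV (hV'.subset h)).2 hs⟩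

theorem step_of_suffix {e : α} {U V : List α} (h : V <:+ U) :
    Step (U ++ e :: (V ++ [e])) (U ++ [e]) := by
  obtain ⟨T, rfl⟩ := h
  exact ⟨T, V ++ [e], [], by simp, by simp, by simp⟩

theorem squareFree_append_cons_append_singleton {e : α} {U V : List α} (hU : e ∉ U) (hV : e ∉ V) :
    SquareFree (U ++ e :: (V ++ [e])) ↔ SquareFree U ∧ SquareFree V ∧ ¬ V <:+ U := by
  simp only [squareFree_iff_forall_not_step]
  constructor
  · refine fun h => ⟨fun W' hW' => h _ (hW'.append_right _), fun W' hW' => ?_, fun hs =>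
      h _ (step_of_suffix hs)⟩
    have := (hW'.append_right [e]).append_left (U ++ [e])
    exact h (U ++ e :: (W' ++ [e])) (by simpa using this)
  · rintro ⟨h1, h2, h3⟩ Z hZ
    rcases step_append_cons_append_singleton hU hV hZ with ⟨_, h, -⟩ | ⟨_, h, -⟩ | ⟨h, -⟩
    exacts [h1 _ h, h2 _ h, h3 h]

theorem reaches_append_cons_append_singleton {e : α} {U V U' V' : List α} (hU : Reaches U U')
    (hV : Reaches V V') : Reaches (U ++ e :: (V ++ [e])) (U' ++ e :: (V' ++ [e])) := by
  refine (hU.append_right _).trans ?_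
  have := (hV.append_right [e]).append_left (U' ++ [e])
  simpa [Reaches] using this

theorem reducts_append_cons_append_singleton {e : α} {U V : List α} (hU : e ∉ U) (hV : e ∉ V) :
    Reducts (U ++ e :: (V ++ [e])) =
      {Z | ∃ R ∈ Reducts U, ∃ Q ∈ Reducts V, ¬ Q <:+ R ∧ Z = R ++ e :: (Q ++ [e])} ∪
      {Z | ∃ R ∈ Reducts U, (∃ Q, Reaches V Q ∧ ∃ R', Reaches U R' ∧ Q <:+ R' ∧ Reaches R' R) ∧
        Z = R ++ [e]} := by
  ext Z
  constructor
  · rintro ⟨hZ, hs⟩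
    have key : (∃ R Q, Reaches U R ∧ Reaches V Q ∧ Z = R ++ e :: (Q ++ [e])) ∨
        ∃ R, Reaches U R ∧
          (∃ Q, Reaches V Q ∧ ∃ R', Reaches U R' ∧ Q <:+ R' ∧ Reaches R' R) ∧ Z = R ++ [e] := by
      clear hs
      induction hZ with
      | refl => exact .inl ⟨U, V, .refl, .refl, rfl⟩
      | tail _ h ih =>
        rcases ih with ⟨R, Q, hR, hQ, rfl⟩ | ⟨R, hR, ⟨Q, hQ, R', hR', hs, hRR⟩, rfl⟩
        · rcases step_append_cons_append_singleton (fun h => hU (hR.subset h))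
            (fun h => hV (hQ.subset h)) h with ⟨R', h', rfl⟩ | ⟨Q', h', rfl⟩ | ⟨h', rfl⟩
          · exact .inl ⟨R', Q, hR.tail h', hQ, rfl⟩
          · exact .inl ⟨R, Q', hR, hQ.tail h', rfl⟩
          · exact .inr ⟨R, hR, ⟨Q, hQ, R, hR, h', .refl⟩, rfl⟩
        · obtain ⟨R'', h', rfl⟩ := step_append_singleton (fun h => hU (hR.subset h)) h
          exact .inr ⟨R'', hR.tail h', ⟨Q, hQ, R', hR', hs, hRR.tail h'⟩, rfl⟩
    rcases key with ⟨R, Q, hR, hQ, rfl⟩ | ⟨R, hR, hex, rfl⟩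
    · obtain ⟨h1, h2, h3⟩ := (squareFree_append_cons_append_singleton
        (fun h => hU (hR.subset h)) (fun h => hV (hQ.subset h))).1 hs
      exact .inl ⟨R, ⟨hR, h1⟩, Q, ⟨hQ, h2⟩, h3, rfl⟩
    · exact .inr ⟨R, ⟨hR, (squareFree_append_singleton fun h => hU (hR.subset h)).1 hs⟩, hex, rfl⟩
  · rintro (⟨R, hR, Q, hQ, hs, rfl⟩ | ⟨R, hR, ⟨Q, hQ, R', hR', hs, hRR⟩, rfl⟩)
    · exact ⟨reaches_append_cons_append_singleton hR.1 hQ.1,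
        (squareFree_append_cons_append_singleton (fun h => hU (hR.1.subset h))
          (fun h => hV (hQ.1.subset h))).2 ⟨hR.2, hQ.2, hs⟩⟩
    · exact ⟨((reaches_append_cons_append_singleton hR' hQ).tail (step_of_suffix hs)).trans
        (hRR.append_right _), (squareFree_append_singleton fun h => hU (hR.1.subset h)).2 hR.2⟩

theorem IsCountingPair.succ {k : ℕ} (hk : 0 < k) {e : α} {P Y : List α} (hPe : e ∉ P)
    (hYe : e ∉ Y) (h : IsCountingPair k P Y) :
    IsCountingPair (k + 1) (P ++ e :: (Y ++ [e])) (Y ++ [e]) := by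
  obtain ⟨hP, hk', Q₁, Q₂, R₁, hY, hQ, hR₁, hQR, hall⟩ := h
  have hfin : (Reducts P).Finite := Set.finite_of_ncard_pos (by omega)
  have hsuf : ∀ {A B : List α}, A <:+ B → A ++ [e] <:+ B ++ [e] := by
    rintro A _ ⟨T, rfl⟩
    exact ⟨T, by simp⟩
  have hred : Reducts (P ++ e :: (Y ++ [e])) =
      insert (R₁ ++ e :: (Q₂ ++ [e])) ((· ++ [e]) '' Reducts P) := by
    rw [reducts_append_cons_append_singleton hPe hYe, hY]
    ext Z
    constructor
    · rintro (⟨R, hR, Q, rfl | rfl, hs, rfl⟩ | ⟨R, hR, -, rfl⟩)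
      · exact (hs (hall R hR).1).elim
      · by_cases hRR : R = R₁
        · exact .inl (hRR ▸ rfl)
        · exact (hs ((hall R hR).2 hRR)).elim
      · exact .inr ⟨R, hR, rfl⟩
    · rintro (rfl | ⟨R, hR, rfl⟩)
      · exact .inl ⟨R₁, hR₁, Q₂, .inr rfl, hQR, rfl⟩
      · have hQ₁ : Q₁ ∈ Reducts Y := hY ▸ .inl rfl
        exact .inr ⟨R, hR, ⟨Q₁, hQ₁.1, R, hR.1, (hall R hR).1, .refl⟩, rfl⟩
  refine ⟨by simp, ?_, Q₁ ++ [e], Q₂ ++ [e], R₁ ++ [e], ?_, hsuf hQ, ?_, ?_, ?_⟩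
  · rw [hred, Set.ncard_insert_of_notMem _ (hfin.image _),
      Set.ncard_image_of_injective _ (List.append_left_injective _), hk']
    rintro ⟨R, hR, h⟩
    have h' : R = R₁ ++ e :: Q₂ := List.append_cancel_right (bs := [e]) (by simpa using h)
    exact hPe (hR.1.subset (h' ▸ by simp))
  · rw [reducts_append_singleton hYe, hY, Set.image_pair]
  · rw [hred]
    exact .inr ⟨R₁, hR₁, rfl⟩
  · rintro ⟨T, h⟩
    exact hQR ⟨T, List.append_cancel_right (bs := [e]) (by simpa using h)⟩
  · rw [hred]
    rintro _ (rfl | ⟨R, hR, rfl⟩)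
    · exact ⟨(hsuf hQ).trans ⟨R₁ ++ [e], by simp⟩, fun _ => ⟨R₁ ++ [e], by simp⟩⟩
    · exact ⟨hsuf (hall R hR).1, fun hne => hsuf ((hall R hR).2 fun h => hne (h ▸ rfl))⟩

end Counting

section Existence

theorem Step.exists_lt_length {α : Type*} {W Z : List α} (h : Step W Z) :
    ∃ a < W.length, ∃ p < W.length,
      (0 < p ∧ a + 2 * p ≤ W.length ∧ (W.drop a).take p = (W.drop (a + p)).take p) ∧
        Z = deleteAt W a p := by
  obtain ⟨a, p, hp, hlen, hper, rfl⟩ := step_iff_deleteAt.1 h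
  refine ⟨a, by omega, p, by omega, ⟨hp, hlen, ?_⟩, rfl⟩
  apply List.ext_getElem?
  intro i
  simp only [List.getElem?_take, List.getElem?_drop]
  split_ifs with hi
  · rw [hper _ (by omega) (by omega)]
    congr 1
    omega
  · rfl

theorem squareFree_of_forall_lt_length {α : Type*} {W : List α}
    (h : ∀ a < W.length, ∀ p < W.length, 0 < p → a + 2 * p ≤ W.length →
      (W.drop a).take p ≠ (W.drop (a + p)).take p) : SquareFree W := by
  rw [squareFree_iff_forall_not_step]
  intro Z hZ
  obtain ⟨a, ha, p, hp, ⟨hp0, hlen, heq⟩, -⟩ := hZ.exists_lt_length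
  exact h a ha p hp hp0 hlen heq

theorem reducts_abcbabcbc :
    Reducts ([0, 1, 2, 1, 0, 1, 2, 1, 2] : List (Fin 4)) =
      {[0, 1, 2], [0, 1, 2, 1, 0, 1, 2]} := by
  have hA : SquareFree ([0, 1, 2] : List (Fin 4)) :=
    squareFree_of_forall_lt_length (by decide)
  have hB : SquareFree ([0, 1, 2, 1, 0, 1, 2] : List (Fin 4)) :=
    squareFree_of_forall_lt_length (by decide)
  have hC : ∀ Z, Step ([0, 1, 2, 1, 2] : List (Fin 4)) Z → Z = [0, 1, 2] := by
    intro Z hZ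
    obtain ⟨a, ha, p, hp, h, rfl⟩ := hZ.exists_lt_length
    clear hZ
    revert a p
    decide
  have hD : ∀ Z, Step ([0, 1, 2, 1, 0, 1, 2, 1, 2] : List (Fin 4)) Z →
      Z = [0, 1, 2, 1, 2] ∨ Z = [0, 1, 2, 1, 0, 1, 2] := by
    intro Z hZ
    obtain ⟨a, ha, p, hp, h, rfl⟩ := hZ.exists_lt_length
    clear hZ
    revert a p
    decide
  have hDC : Step ([0, 1, 2, 1, 0, 1, 2, 1, 2] : List (Fin 4)) [0, 1, 2, 1, 2] :=
    ⟨[], [0, 1, 2, 1], [2], by simp, rfl, rfl⟩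
  have hDB : Step ([0, 1, 2, 1, 0, 1, 2, 1, 2] : List (Fin 4)) [0, 1, 2, 1, 0, 1, 2] :=
    ⟨[0, 1, 2, 1, 0], [1, 2], [], by simp, rfl, rfl⟩
  have hCA : Step ([0, 1, 2, 1, 2] : List (Fin 4)) [0, 1, 2] :=
    ⟨[0], [1, 2], [], by simp, rfl, rfl⟩
  ext R
  constructor
  · rintro ⟨hR, hs⟩
    rcases Relation.ReflTransGen.cases_head hR with rfl | ⟨Z, hZ, hR⟩
    · exact (squareFree_iff_forall_not_step.1 hs _ hDC).elim
    rcases hD Z hZ with rfl | rfl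
    · rcases Relation.ReflTransGen.cases_head hR with rfl | ⟨Z, hZ, hR⟩
      · exact (squareFree_iff_forall_not_step.1 hs _ hCA).elim
      · obtain rfl := hC Z hZ
        exact .inl (hA.reducts_eq.subset ⟨hR, hs⟩)
    · exact .inr (hB.reducts_eq.subset ⟨hR, hs⟩)
  · rintro (rfl | rfl)
    · exact ⟨.head hDC (.single hCA), hA⟩
    · exact ⟨.single hDB, hB⟩

theorem isCountingPair_one :
    IsCountingPair 1 ([0, 1, 2] : List (Fin 4)) [0, 1, 2, 1, 0, 1, 2, 1, 2] := by
  have hA : Reducts ([0, 1, 2] : List (Fin 4)) = {[0, 1, 2]} :=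
    (squareFree_of_forall_lt_length (by decide)).reducts_eq
  refine ⟨by simp, by rw [hA, Set.ncard_singleton], _, _, [0, 1, 2], reducts_abcbabcbc,
    by decide, by rw [hA]; rfl, by decide, ?_⟩
  rw [hA]
  rintro _ rfl
  exact ⟨List.suffix_rfl, fun h => (h rfl).elim⟩

theorem isStepEmbedding_encode_comp_map :
    IsStepEmbedding fun W : List (Fin 4) => encode (W.map Fin.castSucc) where
  injective := encode_injective.comp (isStepEmbedding_map (Fin.castSucc_injective 4)).injective
  map_step h := isStepEmbedding_encode.map_step
    ((isStepEmbedding_map (Fin.castSucc_injective 4)).map_step h)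
  exists_of_step h := by
    obtain ⟨Z, hZ, rfl⟩ := isStepEmbedding_encode.exists_of_step h
    obtain ⟨W', hW', rfl⟩ := (isStepEmbedding_map (Fin.castSucc_injective 4)).exists_of_step hZ
    exact ⟨W', hW', rfl⟩
  suffix_iff := isStepEmbedding_encode.suffix_iff.trans
    (isStepEmbedding_map (Fin.castSucc_injective 4)).suffix_iff
  map_nil := rfl

theorem exists_isCountingPair (k : ℕ) (hk : 0 < k) :
    ∃ P Y : List (Fin 4), IsCountingPair k P Y := by
  induction k, hk using Nat.le_induction with
  | base => exact ⟨_, _, isCountingPair_one⟩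
  | succ k hk ih =>
    obtain ⟨P, Y, h⟩ := ih
    have hlast : ∀ W : List (Fin 4), Fin.last 4 ∉ W.map Fin.castSucc := by
      intro W hW
      obtain ⟨x, -, hx⟩ := List.mem_map.1 hW
      exact Fin.castSucc_ne_last x hx
    exact ⟨_, _, ((h.map (isStepEmbedding_map (Fin.castSucc_injective 4))).succ hk
      (hlast P) (hlast Y)).map isStepEmbedding_encode⟩

end Existence

/-- For every positive integer `k` there are infinitely many words over a four-letter
alphabet each having exactly `k` distinct square-free reducts. -/
theorem four_letters_infinitely_many_words (k : ℕ) (hk : 0 < k) :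
    {W : List (Fin 4) | (Reducts W).ncard = k}.Infinite := by
  obtain ⟨P, -, hP, hPk, -⟩ := exists_isCountingPair k hk
  intro hfin
  have key : ∀ n, ∃ W : List (Fin 4), (Reducts W).ncard = k ∧ n < W.length := by
    intro n
    induction n with
    | zero => exact ⟨P, hPk, List.length_pos_iff.2 hP⟩
    | succ n ih =>
      obtain ⟨W, hW, hn⟩ := ih
      refine ⟨encode (W.map Fin.castSucc), ?_, ?_⟩
      · rw [isStepEmbedding_encode_comp_map.ncard_reducts, hW]
      · rw [length_encode, List.length_map]
        omega
  obtain ⟨M, hM⟩ := (hfin.image List.length).bddAbove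
  obtain ⟨W, hW, hlt⟩ := key M
  exact (hM (Set.mem_image_of_mem _ hW)).not_gt hlt
end

section
/- The equivalence relation on the set of all nonempty finite words over a three-letter alphabet generated by single square reductions (i.e. two words are equivalent if one can be obtained from the other by a finite sequence of square reductions and factor duplications) has only finitely many equivalence classes; equivalently, the undirected graph G_3 on all nonempty ternary words, in which two words are adjacent whenever one is obtained from the other by a single square reduction, has finitely many connected components. -/
/-- In an idempotent monoid, the value of a word is absorbed on the right by anything that
starts with a word over the same letters. -/
theorem exists_mul_prod_mul_eq {α M : Type*} [Monoid M] (hM : ∀ x : M, x * x = x) (f : α → M)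
    (y x : List α) (h : y ⊆ x) :
    ∃ z : M, (x.map f).prod * (y.map f).prod * z = (x.map f).prod := by
  induction y generalizing x with
  | nil => exact ⟨1, by simp⟩
  | cons a y ih =>
    obtain ⟨ha, hy⟩ := List.cons_subset.mp h
    obtain ⟨z, hz⟩ := ih (x ++ [a]) fun b hb => List.mem_append_left _ (hy hb)
    obtain ⟨u, v, rfl⟩ := List.append_of_mem ha
    refine ⟨z * (v.map f).prod, ?_⟩
    have key := congrArg (· * (v.map f).prod) hz
    have idem := hM (f a * (v.map f).prod)
    simp only [List.map_append, List.map_cons, List.map_nil, List.prod_append, List.prod_cons,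
      List.prod_nil, mul_one, mul_assoc] at key idem ⊢
    rw [key, idem]

theorem prod_mul_prod_mul_prod_eq {α M : Type*} [Monoid M] (hM : ∀ x : M, x * x = x)
    (f : α → M) {x y : List α} (h : y ⊆ x) :
    (x.map f).prod * (y.map f).prod * (x.map f).prod = (x.map f).prod := by
  obtain ⟨z, hz⟩ := exists_mul_prod_mul_eq hM f y x h
  calc (x.map f).prod * (y.map f).prod * (x.map f).prod
      = ((x.map f).prod * (y.map f).prod) * ((x.map f).prod * (y.map f).prod) * z := by
        rw [mul_assoc _ _ z, hz]
    _ = (x.map f).prod := by rw [hM, hz]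

/-- In an idempotent monoid, the value of a word is determined by a prefix and a suffix
that both contain all of its letters. -/
theorem prod_eq_prefix_mul_suffix {α M : Type*} [Monoid M] (hM : ∀ x : M, x * x = x)
    (f : α → M) {w p p' s s' : List α} (hp : w = p ++ p') (hs : w = s' ++ s)
    (hwp : w ⊆ p) (hws : w ⊆ s) :
    (w.map f).prod = (p.map f).prod * (s.map f).prod := by
  have hpw : p ⊆ w := hp ▸ List.subset_append_left _ _
  have hsw : s ⊆ w := hs ▸ List.subset_append_right _ _
  have hp'w : p' ⊆ w := hp ▸ List.subset_append_right _ _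
  have hs'w : s' ⊆ w := hs ▸ List.subset_append_left _ _
  have h₁ := prod_mul_prod_mul_prod_eq hM f (x := p) (y := s) fun _ h => hwp (hsw h)
  have h₂ := prod_mul_prod_mul_prod_eq hM f (x := s) (y := p ++ p' ++ s') fun b h => by
    simp only [List.mem_append] at h
    rcases h with (h | h) | h
    exacts [hws (hpw h), hws (hp'w h), hws (hs'w h)]
  have e₁ : (w.map f).prod = (p.map f).prod * (p'.map f).prod := by simp [hp]
  have e₂ : (w.map f).prod = (s'.map f).prod * (s.map f).prod := by simp [hs]
  simp only [List.map_append, List.prod_append] at h₂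
  calc (w.map f).prod
      = ((p.map f).prod * (p'.map f).prod) * ((s'.map f).prod * (s.map f).prod) := by
        rw [← e₁, ← e₂, hM]
    _ = ((p.map f).prod * (s.map f).prod * (p.map f).prod * (p'.map f).prod) *
          ((s'.map f).prod * (s.map f).prod) := by rw [h₁]
    _ = (p.map f).prod * ((s.map f).prod *
          ((p.map f).prod * (p'.map f).prod * (s'.map f).prod) * (s.map f).prod) := by
        simp only [mul_assoc]
    _ = (p.map f).prod * (s.map f).prod := by rw [h₂]

theorem exists_prefix_card_toFinset {α : Type*} [DecidableEq α] (n : ℕ) (w : List α)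
    (h : w.toFinset.card = n + 1) :
    ∃ p a p', w = (p ++ [a]) ++ p' ∧ w ⊆ p ++ [a] ∧ p.toFinset.card = n := by
  induction w using List.reverseRecOn with
  | nil => simp at h
  | append_singleton w b ih =>
    by_cases hb : b ∈ w
    · have hw : (w ++ [b]).toFinset = w.toFinset := by
        ext c; simp only [List.mem_toFinset, List.mem_append, List.mem_singleton]
        exact ⟨fun h => h.elim id fun h => h ▸ hb, Or.inl⟩
      obtain ⟨p, a, p', h₁, h₂, h₃⟩ := ih (hw ▸ h)
      refine ⟨p, a, p' ++ [b], by rw [← List.append_assoc, ← h₁], fun c hc => h₂ ?_, h₃⟩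
      rwa [← List.mem_toFinset, hw, List.mem_toFinset] at hc
    · refine ⟨w, b, [], by simp, fun _ h => h, ?_⟩
      have hw : (w ++ [b]).toFinset = insert b w.toFinset := by ext c; simp
      rw [hw, Finset.card_insert_of_notMem (by simpa using hb)] at h
      omega

theorem exists_suffix_card_toFinset {α : Type*} [DecidableEq α] (n : ℕ) (w : List α)
    (h : w.toFinset.card = n + 1) :
    ∃ s' a s, w = s' ++ a :: s ∧ w ⊆ a :: s ∧ s.toFinset.card = n := by
  obtain ⟨p, a, p', h₁, h₂, h₃⟩ :=
    exists_prefix_card_toFinset n w.reverse (by rwa [List.toFinset_reverse])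
  refine ⟨p'.reverse, a, p.reverse, ?_, fun c hc => ?_, by rwa [List.toFinset_reverse]⟩
  · rw [← List.reverse_reverse w, h₁]; simp
  · simpa [or_comm] using h₂ (List.mem_reverse.mpr hc)

theorem finite_prod_of_card_toFinset_eq {α M : Type*} [DecidableEq α] [Finite α] [Monoid M]
    (hM : ∀ x : M, x * x = x) (f : α → M) (n : ℕ) :
    {m : M | ∃ w : List α, w.toFinset.card = n ∧ (w.map f).prod = m}.Finite := by
  induction n with
  | zero =>
    refine (Set.finite_singleton (1 : M)).subset ?_
    rintro _ ⟨w, hw, rfl⟩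
    simp_all
  | succ n ih =>
    have hf := Set.finite_range f
    refine (Set.Finite.image2 (· * ·) (Set.Finite.image2 (· * ·) ih hf)
      (Set.Finite.image2 (· * ·) hf ih)).subset ?_
    rintro _ ⟨w, hw, rfl⟩
    obtain ⟨p, a, p', hp, hwp, hpn⟩ := exists_prefix_card_toFinset n w hw
    obtain ⟨s', b, s, hs, hws, hsn⟩ := exists_suffix_card_toFinset n w hw
    refine ⟨_, ⟨_, ⟨p, hpn, rfl⟩, f a, ⟨a, rfl⟩, rfl⟩,
      _, ⟨f b, ⟨b, rfl⟩, _, ⟨s, hsn, rfl⟩, rfl⟩, ?_⟩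
    rw [prod_eq_prefix_mul_suffix hM f hp hs hwp hws]
    simp

/-- Finitely generated idempotent monoids are finite (Green–Rees). -/
theorem finite_range_prod_map {α M : Type*} [Finite α] [Monoid M]
    (hM : ∀ x : M, x * x = x) (f : α → M) :
    (Set.range fun w : List α => (w.map f).prod).Finite := by
  classical
  have := Fintype.ofFinite α
  refine ((Set.finite_Iic (Fintype.card α)).biUnion fun n _ =>
    finite_prod_of_card_toFinset_eq hM f n).subset ?_
  rintro _ ⟨w, rfl⟩
  exact Set.mem_biUnion (Set.mem_Iic.mpr (Finset.card_le_univ w.toFinset)) ⟨w, rfl, rfl⟩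

theorem Step.append_append {α : Type*} {W W' : List α} (h : Step W W') (A B : List α) :
    Step (A ++ W ++ B) (A ++ W' ++ B) := by
  obtain ⟨U, X, V, hX, rfl, rfl⟩ := h
  exact ⟨A ++ U, X, V ++ B, hX, by simp, by simp⟩

theorem eqvGen_step_append_append {α : Type*} {W W' : List α} (h : Relation.EqvGen Step W W')
    (A B : List α) : Relation.EqvGen Step (A ++ W ++ B) (A ++ W' ++ B) := by
  induction h with
  | rel _ _ h => exact .rel _ _ (h.append_append A B)
  | refl => exact .refl _
  | symm _ _ _ ih => exact .symm _ _ ih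
  | trans _ _ _ _ _ ih₁ ih₂ => exact .trans _ _ _ ih₁ ih₂

/-- The congruence on the free monoid generated by square reductions. -/
def squareCon (α : Type*) : Con (FreeMonoid α) where
  r W V := Relation.EqvGen Step W.toList V.toList
  iseqv := ⟨fun _ => .refl _, fun h => .symm _ _ h, fun h₁ h₂ => .trans _ _ _ h₁ h₂⟩
  mul' {W W' V V'} h₁ h₂ := by
    have e₁ := eqvGen_step_append_append h₁ [] V.toList
    have e₂ := eqvGen_step_append_append h₂ W'.toList []
    simp only [List.nil_append, List.append_nil] at e₁ e₂
    exact .trans _ _ _ e₁ e₂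

theorem squareCon_mul_self {α : Type*} (x : (squareCon α).Quotient) : x * x = x := by
  induction x using Con.induction_on with
  | H W =>
    rw [← Con.coe_mul, Con.eq]
    by_cases hW : W.toList = []
    · obtain rfl : W = 1 := hW
      exact .refl _
    · exact .rel _ _ ⟨[], W.toList, [], hW, by simp, by simp⟩

theorem prod_map_squareCon {α : Type*} (W : List α) :
    (W.map fun a => ((FreeMonoid.of a : FreeMonoid α) : (squareCon α).Quotient)).prod =
      (FreeMonoid.ofList W : FreeMonoid α) := by
  induction W with
  | nil => rfl
  | cons a W ih => rw [List.map_cons, List.prod_cons, ih, ← Con.coe_mul]; rfl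

/-- The equivalence relation on nonempty ternary words generated by single square
reductions has only finitely many equivalence classes: the graph `G₃` has finitely
many connected components. -/
theorem finitely_many_components :
    {C : Set (List (Fin 3)) |
      ∃ W : List (Fin 3), W ≠ [] ∧ C = {V | Relation.EqvGen Step W V}}.Finite := by 
  have hfin := finite_range_prod_map squareCon_mul_self
    fun a : Fin 3 => ((FreeMonoid.of a : FreeMonoid (Fin 3)) : (squareCon (Fin 3)).Quotient)
  refine (hfin.image fun m => {V : List (Fin 3) |
    m = ((FreeMonoid.ofList V : FreeMonoid (Fin 3)) : (squareCon (Fin 3)).Quotient)}).subset ?_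
  rintro _ ⟨W, -, rfl⟩
  refine ⟨_, ⟨W, rfl⟩, Set.ext fun V => ?_⟩
  simp only [prod_map_squareCon, Set.mem_ofPred_eq]
  exact Con.eq _
end
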